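/- Let Π.φ be a quantified Horn formula, let C be a Horn clause with all variables among those of Π, and let i be the maximum level of the literals of C. If the abstraction Π_i.(φ ∧ C̄) has an SLD-Q-resolution refutation, where C̄ denotes the conjunction of unit clauses {¬ℓ} for each literal ℓ of C, then Π.φ and Π.(φ ∧ C) are logically equivalent. -/

import Mathlib

attribute [local instance] Classical.propDecidable

namespace QHornProlog

/-- Propositional variables. -/
abbrev Var := ℕ
/-- A literal is a variable together with a polarity (`true` = positive). -/
abbrev Lit := Var × Bool
/-- A clause is a finite set of literals. -/
abbrev Clause := Finset Lit
/-- A CNF formula is a finite set of clauses. -/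
abbrev CNF := Finset Clause
/-- A Boolean assignment to the variables. -/
abbrev Assignment := Var → Bool

/-- An assignment makes a literal true. -/
def litSat (a : Assignment) (l : Lit) : Prop := a l.1 = l.2
/-- An assignment satisfies a clause if some literal of it is made true. -/
def clauseSat (a : Assignment) (C : Clause) : Prop := ∃ l ∈ C, litSat a l
/-- An assignment satisfies a CNF if it satisfies every clause. -/
def cnfSat (a : Assignment) (F : CNF) : Prop := ∀ C ∈ F, clauseSat a C
/-- A CNF formula is satisfiable if some assignment satisfies it. -/
def CnfSatisfiable (F : CNF) : Prop := ∃ a, cnfSat a F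

/-- The positive literals of a clause. -/
def posLits (C : Clause) : Clause := C.filter (fun l => l.2 = true)
/-- A Horn clause has at most one positive literal. -/
def IsHornClause (C : Clause) : Prop := (posLits C).card ≤ 1
/-- A definite Horn clause has exactly one positive literal. -/
def IsDefiniteClause (C : Clause) : Prop := (posLits C).card = 1
/-- A negative (goal) clause has only negative literals. -/
def IsNegativeClause (C : Clause) : Prop := ∀ l ∈ C, l.2 = false
/-- A Horn formula consists of Horn clauses. -/
def IsHornFormula (F : CNF) : Prop := ∀ C ∈ F, IsHornClause C

/-- `R` is the resolvent of `C` and `D` on pivot `x`. -/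
def IsResolvent (C D R : Clause) (x : Var) : Prop :=
  (x, true) ∈ C ∧ (x, false) ∈ D ∧ R = C.erase (x, true) ∪ D.erase (x, false)

/-- A unit resolution refutation of `F`: a sequence of clauses ending in the empty
clause, each either in `F` or a resolvent of two earlier clauses where at least one
premise is a unit clause. -/
def IsUnitResRefutation (F : CNF) (L : List Clause) : Prop :=
  L ≠ [] ∧ L.getLast? = some (∅ : Clause) ∧
  ∀ i (hi : i < L.length),
    L.get ⟨i, hi⟩ ∈ F ∨
    ∃ j k, ∃ (hj : j < i) (hk : k < i), ∃ x : Var,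
      ((L.get ⟨j, hj.trans hi⟩).card = 1 ∨ (L.get ⟨k, hk.trans hi⟩).card = 1) ∧
      IsResolvent (L.get ⟨j, hj.trans hi⟩) (L.get ⟨k, hk.trans hi⟩) (L.get ⟨i, hi⟩) x

/-- An SLD-resolution refutation of `F`: a sequence of negative clauses starting at a
goal clause of `F`, each next clause the resolvent of the previous (centre) clause with
a definite clause of `F` (side clause) on its head, ending in the empty clause. -/
def IsSLDRefutation (F : CNF) (L : List Clause) : Prop :=
  ∃ h : L ≠ [],
    L.head h ∈ F ∧ IsNegativeClause (L.head h) ∧ L.getLast h = (∅ : Clause) ∧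
    ∀ i (hi : i + 1 < L.length),
      ∃ C ∈ F, ∃ x : Var,
        posLits C = {(x, true)} ∧ (x, false) ∈ L.get ⟨i, Nat.lt_of_succ_lt hi⟩ ∧
        L.get ⟨i + 1, hi⟩ =
          (L.get ⟨i, Nat.lt_of_succ_lt hi⟩).erase (x, false) ∪ C.erase (x, true)

/-! ### Quantified Boolean formulas in closed prenex form -/

/-- A quantifier prefix: a list of blocks, each a quantifier (`true` = ∃, `false` = ∀)
together with a finite set of variables. -/
abbrev QPrefix := List (Bool × Finset Var)

/-- All variables occurring in the prefix. -/
def prefixVars (Pf : QPrefix) : Finset Var := Pf.foldr (fun p s => p.2 ∪ s) ∅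
/-- Variables of a clause. -/
def clauseVars (C : Clause) : Finset Var := C.image Prod.fst
/-- Variables of a CNF. -/
def cnfVars (F : CNF) : Finset Var := F.sup clauseVars

/-- Override an assignment on the set `X` by the assignment `b`. -/
def override (a : Assignment) (X : Finset Var) (b : Assignment) : Assignment :=
  fun v => if v ∈ X then b v else a v

/-- Recursive truth evaluation of a prenex QBF relative to an ambient assignment:
an ∃-block requires some assignment of its variables, a ∀-block requires all. -/
def QEval : QPrefix → CNF → Assignment → Prop
  | [], φ, a => cnfSat a φ
  | (true, X) :: Pf, φ, a => ∃ b, QEval Pf φ (override a X b)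
  | (false, X) :: Pf, φ, a => ∀ b, QEval Pf φ (override a X b)

/-- Truth of a closed prenex QBF. -/
def QTrue (Pf : QPrefix) (φ : CNF) : Prop := QEval Pf φ (fun _ => false)

/-- `Pf.φ` is a closed prenex QBF: the blocks are pairwise disjoint and every variable
of the matrix is quantified. -/
def ClosedQBF (Pf : QPrefix) (φ : CNF) : Prop :=
  Pf.Pairwise (fun p q => Disjoint p.2 q.2) ∧ cnfVars φ ⊆ prefixVars Pf

/-- A variable is existential if it lies in an ∃-block. -/
def IsExistential (Pf : QPrefix) (v : Var) : Prop := ∃ p ∈ Pf, p.1 = true ∧ v ∈ p.2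
/-- A variable is universal if it lies in a ∀-block. -/
def IsUniversal (Pf : QPrefix) (v : Var) : Prop := ∃ p ∈ Pf, p.1 = false ∧ v ∈ p.2
/-- A quantified Horn formula: a closed prenex QBF with a Horn matrix. -/
def IsQHorn (Pf : QPrefix) (φ : CNF) : Prop := ClosedQBF Pf φ ∧ IsHornFormula φ

/-- Variable `v` lies in block number `i` (0-indexed) of the prefix. -/
def hasLevel (Pf : QPrefix) (v : Var) (i : ℕ) : Prop :=
  ∃ h : i < Pf.length, v ∈ (Pf.get ⟨i, h⟩).2
/-- Variable `v` is at or to the left of variable `w` in the prefix ordering. -/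
def levelLE (Pf : QPrefix) (v w : Var) : Prop :=
  ∃ i j, i ≤ j ∧ hasLevel Pf v i ∧ hasLevel Pf w j

/-- Clauses of the matrix with exactly one positive literal, which is existential. -/
noncomputable def Fexist (Pf : QPrefix) (φ : CNF) : CNF :=
  φ.filter (fun C => ∃ x, posLits C = {(x, true)} ∧ IsExistential Pf x)
/-- Clauses of the matrix with exactly one positive literal, which is universal. -/
noncomputable def Fforall (Pf : QPrefix) (φ : CNF) : CNF :=
  φ.filter (fun C => ∃ x, posLits C = {(x, true)} ∧ IsUniversal Pf x)
/-- Goal clauses: clauses with only negative literals. -/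
noncomputable def Fgoal (φ : CNF) : CNF := φ.filter IsNegativeClause

/-- One SLD-Q-resolution step from centre clause `N` to `N'`: either resolution with a
definite clause of `φ` on its existential head, or universal reduction of a universal
literal not blocked by any existential literal at or to its right. -/
def SLDQStep (Pf : QPrefix) (φ : CNF) (N N' : Clause) : Prop :=
  (∃ C ∈ φ, ∃ x : Var, posLits C = {(x, true)} ∧ IsExistential Pf x ∧
     (x, false) ∈ N ∧ N' = N.erase (x, false) ∪ C.erase (x, true)) ∨
  (∃ l ∈ N, IsUniversal Pf l.1 ∧
     (∀ k ∈ N, IsExistential Pf k.1 → ¬ levelLE Pf l.1 k.1) ∧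
     N' = N.erase l)

/-- An SLD-Q-resolution refutation of `Pf.φ`: a sequence of negative clauses starting
at a goal clause of `φ`, proceeding by SLD-Q-resolution steps, ending in the empty
clause. -/
def IsSLDQRefutation (Pf : QPrefix) (φ : CNF) (L : List Clause) : Prop :=
  ∃ h : L ≠ [],
    L.head h ∈ φ ∧ IsNegativeClause (L.head h) ∧ L.getLast h = (∅ : Clause) ∧
    ∀ i (hi : i + 1 < L.length),
      SLDQStep Pf φ (L.get ⟨i, Nat.lt_of_succ_lt hi⟩) (L.get ⟨i + 1, hi⟩)

/-! ### Skolem-function models and logical equivalence -/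

/-- A family of candidate Skolem functions: to every variable a function from
assignments to Booleans. -/
abbrev SkolemFamily := Var → Assignment → Bool

/-- Variables of the first `i` blocks of the prefix. -/
def varsUpTo (Pf : QPrefix) (i : ℕ) : Finset Var := prefixVars (Pf.take i)

/-- Each Skolem function for an existential variable depends only on the variables
quantified to the left of it (i.e. in strictly earlier blocks). -/
def DependsOnlyOuter (Pf : QPrefix) (σ : SkolemFamily) : Prop :=
  ∀ i (hi : i < Pf.length), (Pf.get ⟨i, hi⟩).1 = true →
    ∀ v ∈ (Pf.get ⟨i, hi⟩).2, ∀ a b : Assignment,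
      (∀ w ∈ varsUpTo Pf i, a w = b w) → σ v a = σ v b

/-- A complete assignment is consistent with the Skolem family if every existential
variable takes the value prescribed by its Skolem function. -/
def ConsistentWith (Pf : QPrefix) (σ : SkolemFamily) (a : Assignment) : Prop :=
  ∀ v, IsExistential Pf v → a v = σ v a

/-- `σ` is a model of `Pf.φ`: its functions depend only on outer variables and every
consistent complete assignment satisfies the matrix. -/
def IsModel (Pf : QPrefix) (φ : CNF) (σ : SkolemFamily) : Prop :=
  DependsOnlyOuter Pf σ ∧ ∀ a : Assignment, ConsistentWith Pf σ a → cnfSat a φ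

/-- Two QBFs with the same prefix are logically equivalent iff they have exactly the
same models. -/
def LogEquiv (Pf : QPrefix) (φ φ' : CNF) : Prop :=
  ∀ σ : SkolemFamily, IsModel Pf φ σ ↔ IsModel Pf φ' σ

/-- The abstraction `Pf_i`: all variables of the first `i` blocks are made existential
and put in a single leading ∃-block. -/
def abstraction (Pf : QPrefix) (i : ℕ) : QPrefix :=
  (true, varsUpTo Pf i) :: Pf.drop i

/-- The complement of a literal. -/
def negLit (l : Lit) : Lit := (l.1, !l.2)

/-- `C̄`: the conjunction (CNF) of unit clauses `{¬ℓ}` for the literals `ℓ` of `C`. -/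
def negUnits (C : Clause) : CNF := C.image (fun l => ({negLit l} : Clause))

/-- The outer clause `OC(Pf, D, m)`: literals of `D` other than `m` at or to the left
of `m`. -/
noncomputable def outerClause (Pf : QPrefix) (D : Clause) (m : Lit) : Clause :=
  (D.erase m).filter (fun k => levelLE Pf k.1 m.1)

/-- The outer resolvent `OR(Pf, C, D, ℓ)`. -/
noncomputable def outerResolvent (Pf : QPrefix) (C D : Clause) (l : Lit) : Clause :=
  C.erase l ∪ outerClause Pf D (negLit l)

/-- Property QIOR⁺ of a clause `C` on literal `ℓ ∈ C` with respect to `Pf.ψ`. -/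
def QIORplus (Pf : QPrefix) (ψ : CNF) (C : Clause) (l : Lit) : Prop :=
  l ∈ C ∧ ∀ D ∈ ψ, negLit l ∈ D → LogEquiv Pf ψ (insert (outerResolvent Pf C D l) ψ)

/-- Restrict every block of a prefix to the variable set `V`. -/
def restrictPrefix (Pf : QPrefix) (V : Finset Var) : QPrefix :=
  Pf.map (fun p => (p.1, p.2 ∩ V))

/-- Normal form of a prefix: drop empty blocks and merge adjacent blocks carrying the
same quantifier. -/
def normalize : QPrefix → QPrefix
  | [] => []
  | p :: Pf =>
    let r := normalize Pf
    if p.2 = ∅ then r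
    else
      match r with
      | [] => [p]
      | q :: r' => if p.1 = q.1 then (p.1, p.2 ∪ q.2) :: r' else p :: q :: r'

/-- `Pf'` extends `Pf` by the new variables `S`, placed arbitrarily in the prefix:
the variables of `Pf'` are those of `Pf` together with `S`, and removing `S` from
`Pf'` gives back `Pf` (up to empty blocks and block splitting). -/
def PrefixExtends (Pf Pf' : QPrefix) (S : Finset Var) : Prop :=
  Disjoint (prefixVars Pf) S ∧
  prefixVars Pf' = prefixVars Pf ∪ S ∧
  normalize (restrictPrefix Pf' (prefixVars Pf)) = normalize Pf

/-- Renaming of a literal with respect to a set `S` of variables. -/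
def renameLit (S : Finset Var) (l : Lit) : Lit := if l.1 ∈ S then negLit l else l
/-- Renaming of a clause. -/
def renameClause (S : Finset Var) (C : Clause) : Clause := C.image (renameLit S)
/-- Renaming of a CNF matrix. -/
def renameCNF (S : Finset Var) (φ : CNF) : CNF := φ.image (renameClause S)


theorem mem_prefixVars {Pf : QPrefix} {v : Var} :
    v ∈ prefixVars Pf ↔ ∃ p ∈ Pf, v ∈ p.2 := by
  induction Pf with
  | nil => simp [prefixVars]
  | cons p Pf ih =>
    have h : prefixVars (p :: Pf) = p.2 ∪ prefixVars Pf := rfl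
    simp [h, ih]

theorem mem_prefixVars_iff_hasLevel {Pf : QPrefix} {v : Var} :
    v ∈ prefixVars Pf ↔ ∃ j, hasLevel Pf v j := by
  rw [mem_prefixVars]
  constructor
  · rintro ⟨p, hp, hv⟩
    obtain ⟨j, hj, rfl⟩ := List.mem_iff_getElem.1 hp
    exact ⟨j, hj, hv⟩
  · rintro ⟨j, hj, hv⟩
    exact ⟨_, List.get_mem _ _, hv⟩

theorem mem_varsUpTo {Pf : QPrefix} {i : ℕ} {v : Var} :
    v ∈ varsUpTo Pf i ↔ ∃ j < i, hasLevel Pf v j := by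
  rw [varsUpTo, mem_prefixVars_iff_hasLevel]
  constructor
  · rintro ⟨j, hj, hv⟩
    rw [List.length_take] at hj
    refine ⟨j, by omega, by omega, ?_⟩
    simpa using hv
  · rintro ⟨j, hji, hj, hv⟩
    refine ⟨j, by rw [List.length_take]; omega, ?_⟩
    simpa using hv

theorem varsUpTo_mono {Pf : QPrefix} {i j : ℕ} (h : i ≤ j) :
    varsUpTo Pf i ⊆ varsUpTo Pf j := by
  intro v hv
  obtain ⟨k, hk, hl⟩ := mem_varsUpTo.1 hv
  exact mem_varsUpTo.2 ⟨k, by omega, hl⟩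

/-- In a prefix with pairwise disjoint blocks every variable has at most one level. -/
theorem hasLevel_unique {Pf : QPrefix} (hd : Pf.Pairwise (fun p q => Disjoint p.2 q.2))
    {v : Var} {i j : ℕ} (hi : hasLevel Pf v i) (hj : hasLevel Pf v j) : i = j := by
  obtain ⟨hi, hvi⟩ := hi
  obtain ⟨hj, hvj⟩ := hj
  rw [List.pairwise_iff_getElem] at hd
  rcases lt_trichotomy i j with h | h | h
  · exact absurd hvj (Finset.disjoint_left.1 (hd i j hi hj h) hvi)
  · exact h
  · exact absurd hvi (Finset.disjoint_left.1 (hd j i hj hi h) hvj)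

theorem isExistential_iff {Pf : QPrefix} {v : Var} :
    IsExistential Pf v ↔
      ∃ j, ∃ h : j < Pf.length, (Pf.get ⟨j, h⟩).1 = true ∧ v ∈ (Pf.get ⟨j, h⟩).2 := by
  constructor
  · rintro ⟨p, hp, hq, hv⟩
    obtain ⟨j, hj, rfl⟩ := List.mem_iff_getElem.1 hp
    exact ⟨j, hj, hq, hv⟩
  · rintro ⟨j, hj, hq, hv⟩
    exact ⟨_, List.get_mem _ _, hq, hv⟩

/-- Any assignment of the non-existential variables extends to a consistent one. -/
theorem exists_consistentWith {Pf : QPrefix} {σ : SkolemFamily}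
    (hd : Pf.Pairwise (fun p q => Disjoint p.2 q.2)) (hσ : DependsOnlyOuter Pf σ)
    (c : Assignment) :
    ∃ b, ConsistentWith Pf σ b ∧ ∀ v, ¬ IsExistential Pf v → b v = c v := by
  have key : ∀ m, ∃ b : Assignment,
      (∀ j (hj : j < Pf.length), j < m → (Pf.get ⟨j, hj⟩).1 = true →
        ∀ v ∈ (Pf.get ⟨j, hj⟩).2, b v = σ v b) ∧
      ∀ v, ¬ IsExistential Pf v → b v = c v := by
    intro m
    induction m with
    | zero => exact ⟨c, fun j _ h => absurd h (Nat.not_lt_zero j), fun _ _ => rfl⟩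
    | succ m ih =>
      obtain ⟨b, hb, hbc⟩ := ih
      by_cases hm : ∃ h : m < Pf.length, (Pf.get ⟨m, h⟩).1 = true
      · obtain ⟨hm, hq⟩ := hm
        set b' := override b (Pf.get ⟨m, hm⟩).2 (fun v => σ v b) with hb'
        have houter : ∀ w ∈ varsUpTo Pf m, b w = b' w := by
          intro w hw
          obtain ⟨k, hk, hl⟩ := mem_varsUpTo.1 hw
          have : w ∉ (Pf.get ⟨m, hm⟩).2 := fun h =>
            hk.ne (hasLevel_unique hd hl ⟨hm, h⟩)
          simp only [hb', override, if_neg this]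
        refine ⟨b', fun j hj hjm hjq v hv => ?_, fun v hv => ?_⟩
        · have hag : σ v b = σ v b' := hσ j hj hjq v hv b b' fun w hw =>
            houter w (varsUpTo_mono (by omega) hw)
          rw [← hag]
          rcases Nat.lt_succ_iff_lt_or_eq.1 hjm with h | rfl
          · rw [← houter v (mem_varsUpTo.2 ⟨j, h, hj, hv⟩)]
            exact hb j hj h hjq v hv
          · simp only [hb', override, if_pos hv]
        · have : v ∉ (Pf.get ⟨m, hm⟩).2 := fun h =>
            hv (isExistential_iff.2 ⟨m, hm, hq, h⟩)
          simp only [hb', override, if_neg this]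
          exact hbc v hv
      · refine ⟨b, fun j hj hjm hjq v hv => ?_, hbc⟩
        rcases Nat.lt_succ_iff_lt_or_eq.1 hjm with h | rfl
        · exact hb j hj h hjq v hv
        · exact absurd ⟨hj, hjq⟩ hm
  obtain ⟨b, hb, hbc⟩ := key Pf.length
  refine ⟨b, fun v hv => ?_, hbc⟩
  obtain ⟨j, hj, hq, hv⟩ := isExistential_iff.1 hv
  exact hb j hj hj hq v hv

/-- Consistent assignments agreeing on the outer non-existential variables agree on all
outer variables. -/
theorem ConsistentWith.agree {Pf : QPrefix} {σ : SkolemFamily}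
    (hd : Pf.Pairwise (fun p q => Disjoint p.2 q.2)) (hσ : DependsOnlyOuter Pf σ)
    {a b : Assignment} (ha : ConsistentWith Pf σ a) (hb : ConsistentWith Pf σ b) (m : ℕ)
    (h : ∀ v ∈ varsUpTo Pf m, ¬ IsExistential Pf v → a v = b v) :
    ∀ v ∈ varsUpTo Pf m, a v = b v := by
  induction m with
  | zero =>
    intro v hv
    obtain ⟨k, hk, _⟩ := mem_varsUpTo.1 hv
    omega
  | succ m ih =>
    have ih := ih fun v hv => h v (varsUpTo_mono (Nat.le_succ m) hv)
    intro v hv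
    by_cases he : IsExistential Pf v
    · obtain ⟨j, hj, hq, hvj⟩ := isExistential_iff.1 he
      obtain ⟨k, hk, hl⟩ := mem_varsUpTo.1 hv
      obtain rfl := hasLevel_unique hd hl ⟨hj, hvj⟩
      rw [ha v he, hb v he]
      exact hσ k hj hq v hvj a b fun w hw => ih w (varsUpTo_mono (by omega) hw)
    · exact h v hv he

theorem exists_level_of_isUniversal_abstraction {Pf : QPrefix} {i : ℕ} {v : Var}
    (h : IsUniversal (abstraction Pf i) v) :
    ∃ j, hasLevel (abstraction Pf i) v (j + 1) ∧
      ∃ h : i + j < Pf.length, (Pf.get ⟨i + j, h⟩).1 = false ∧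
        v ∈ (Pf.get ⟨i + j, h⟩).2 := by
  obtain ⟨p, hp, hq, hv⟩ := h
  rcases List.mem_cons.1 hp with rfl | hp
  · simp at hq
  · obtain ⟨j, hj, rfl⟩ := List.mem_iff_getElem.1 hp
    rw [List.getElem_drop] at hq
    refine ⟨j, ⟨by simpa [abstraction] using hj, by simpa [abstraction] using hv⟩, ?_⟩
    rw [List.getElem_drop] at hv
    exact ⟨by rw [List.length_drop] at hj; omega, hq, hv⟩

theorem IsExistential.abstraction {Pf : QPrefix} {v : Var} (h : IsExistential Pf v)
    (i : ℕ) : IsExistential (abstraction Pf i) v := by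
  obtain ⟨j, hj, hq, hv⟩ := isExistential_iff.1 h
  by_cases hji : j < i
  · exact ⟨_, List.mem_cons_self, rfl, mem_varsUpTo.2 ⟨j, hji, hj, hv⟩⟩
  · refine ⟨_, List.mem_cons_of_mem _ ?_, hq, hv⟩
    rw [List.mem_drop_iff_getElem]
    refine ⟨j - i, by omega, ?_⟩
    simp [Nat.add_sub_cancel' (not_lt.1 hji)]

/-- An existential variable of the abstraction not at or to the right of a given variable
lies strictly to the left of it in the original prefix. -/
theorem mem_varsUpTo_of_not_levelLE {Pf : QPrefix} {i j : ℕ} {u v : Var}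
    (hu : hasLevel (abstraction Pf i) u (j + 1))
    (hv : IsExistential (abstraction Pf i) v)
    (h : ¬ levelLE (abstraction Pf i) u v) : v ∈ varsUpTo Pf (i + j) := by
  obtain ⟨p, hp, -, hvp⟩ := hv
  rcases List.mem_cons.1 hp with rfl | hp
  · exact varsUpTo_mono (Nat.le_add_right i j) hvp
  · obtain ⟨k, hk, rfl⟩ := List.mem_iff_getElem.1 hp
    have hl : hasLevel (abstraction Pf i) v (k + 1) :=
      ⟨by simpa [abstraction] using hk, by simpa [abstraction] using hvp⟩
    have hkj : k < j := by
      by_contra hkj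
      exact h ⟨j + 1, k + 1, by omega, hu, hl⟩
    rw [List.getElem_drop] at hvp
    exact mem_varsUpTo.2 ⟨i + k, by omega, by rw [List.length_drop] at hk; omega, hvp⟩

theorem clauseSat_resolvent {a : Assignment} {N D : Clause} {x : Var}
    (hN : clauseSat a N) (hD : clauseSat a D) :
    clauseSat a (N.erase (x, false) ∪ D.erase (x, true)) := by
  obtain ⟨k, hk, hka⟩ := hN
  obtain ⟨l, hl, hla⟩ := hD
  by_cases hkx : k = (x, false)
  · refine ⟨l, Finset.mem_union_right _ (Finset.mem_erase.2 ⟨?_, hl⟩), hla⟩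
    rintro rfl
    subst hkx
    simp_all [litSat]
  · exact ⟨k, Finset.mem_union_left _ (Finset.mem_erase.2 ⟨hkx, hk⟩), hka⟩

theorem SLDQStep.isNegativeClause {Pf : QPrefix} {φ : CNF} {N N' : Clause}
    (h : SLDQStep Pf φ N N') (hN : IsNegativeClause N) : IsNegativeClause N' := by
  rcases h with ⟨D, -, x, hD, -, -, rfl⟩ | ⟨l, -, -, -, rfl⟩
  · intro k hk
    rcases Finset.mem_union.1 hk with hk | hk
    · exact hN k (Finset.mem_of_mem_erase hk)
    · obtain ⟨hne, hkD⟩ := Finset.mem_erase.1 hk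
      by_contra hpos
      have : k ∈ posLits D := Finset.mem_filter.2 ⟨hkD, by simpa using hpos⟩
      rw [hD, Finset.mem_singleton] at this
      exact hne this
  · exact fun k hk => hN k (Finset.mem_of_mem_erase hk)

/-- Every SLD-Q-resolution step in the abstraction is sound for the consistent assignments
extending a fixed assignment of the abstracted variables. -/
theorem SLDQStep.sound {Pf : QPrefix} {σ : SkolemFamily} {ψ : CNF} {a : Assignment}
    {i : ℕ} (hd : Pf.Pairwise (fun p q => Disjoint p.2 q.2)) (hσ : DependsOnlyOuter Pf σ)
    (hψ : ∀ b, ConsistentWith Pf σ b → (∀ v ∈ varsUpTo Pf i, b v = a v) → cnfSat b ψ)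
    {N N' : Clause} (hstep : SLDQStep (abstraction Pf i) ψ N N')
    (hneg : IsNegativeClause N)
    (hN : ∀ b, ConsistentWith Pf σ b → (∀ v ∈ varsUpTo Pf i, b v = a v) → clauseSat b N)
    {b : Assignment} (hb : ConsistentWith Pf σ b) (hba : ∀ v ∈ varsUpTo Pf i, b v = a v) :
    clauseSat b N' := by
  rcases hstep with ⟨D, hD, x, -, -, -, rfl⟩ | ⟨l, hl, hlu, hred, rfl⟩
  · exact clauseSat_resolvent (hN b hb hba) (hψ b hb hba D hD)
  · obtain ⟨j, hlev, hj, hq, hlj⟩ := exists_level_of_isUniversal_abstraction hlu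
    obtain ⟨b', hb', hbc⟩ := exists_consistentWith hd hσ (Function.update b l.1 true)
    have hlq : ¬ IsExistential Pf l.1 := fun h => by
      obtain ⟨k, hk, hkq, hlk⟩ := isExistential_iff.1 h
      obtain rfl := hasLevel_unique hd ⟨hk, hlk⟩ ⟨hj, hlj⟩
      rw [hq] at hkq
      exact Bool.noConfusion hkq
    have houter : ∀ v ∈ varsUpTo Pf (i + j), b' v = b v := by
      refine ConsistentWith.agree hd hσ hb' hb _ fun v hv hve => ?_
      rw [hbc v hve, Function.update_of_ne]
      rintro rfl
      obtain ⟨k, hk, hvk⟩ := mem_varsUpTo.1 hv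
      exact hk.ne (hasLevel_unique hd hvk ⟨hj, hlj⟩)
    obtain ⟨k, hk, hkb⟩ := hN b' hb' fun v hv => by
      rw [houter v (varsUpTo_mono (Nat.le_add_right i j) hv), hba v hv]
    have hkl : k.1 ≠ l.1 := fun h => by
      rw [litSat, h, hbc l.1 hlq, Function.update_self, hneg k hk] at hkb
      exact Bool.noConfusion hkb
    refine ⟨k, Finset.mem_erase.2 ⟨fun h => hkl (congrArg Prod.fst h), hk⟩, ?_⟩
    rw [litSat, ← hkb]
    symm
    by_cases hke : IsExistential (abstraction Pf i) k.1
    · exact houter _ (mem_varsUpTo_of_not_levelLE hlev hke (hred k hk hke))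
    · rw [hbc k.1 fun h => hke (h.abstraction i), Function.update_of_ne hkl]

/-- A refutable matrix of the abstraction is violated by some consistent assignment
extending any given assignment of the abstracted variables. -/
theorem IsSLDQRefutation.false_of_cnfSat {Pf : QPrefix} {σ : SkolemFamily} {ψ : CNF}
    {a : Assignment} {i : ℕ} (hd : Pf.Pairwise (fun p q => Disjoint p.2 q.2))
    (hσ : DependsOnlyOuter Pf σ) (ha : ConsistentWith Pf σ a)
    (hψ : ∀ b, ConsistentWith Pf σ b → (∀ v ∈ varsUpTo Pf i, b v = a v) → cnfSat b ψ)
    {L : List Clause} (hL : IsSLDQRefutation (abstraction Pf i) ψ L) : False := by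
  obtain ⟨hne, hhead, hneg, hlast, hstep⟩ := hL
  have key : ∀ m (hm : m < L.length), IsNegativeClause (L.get ⟨m, hm⟩) ∧
      ∀ b, ConsistentWith Pf σ b → (∀ v ∈ varsUpTo Pf i, b v = a v) →
        clauseSat b (L.get ⟨m, hm⟩) := by
    intro m
    induction m with
    | zero =>
      intro hm
      rw [List.head_eq_getElem] at hhead hneg
      exact ⟨hneg, fun b hb hba => hψ b hb hba _ hhead⟩
    | succ m ih =>
      intro hm
      obtain ⟨hneg, hsat⟩ := ih (by omega)
      exact ⟨(hstep m hm).isNegativeClause hneg,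
        fun b hb hba => (hstep m hm).sound hd hσ hψ hneg hsat hb hba⟩
  have hpos := List.length_pos_iff.2 hne
  obtain ⟨l, hl, -⟩ := (key (L.length - 1) (by omega)).2 a ha fun _ _ => rfl
  rw [List.getLast_eq_getElem] at hlast
  rw [List.get_eq_getElem, hlast] at hl
  exact Finset.notMem_empty l hl

/-- Let `Pf.φ` be a quantified Horn formula, `C` a Horn clause over
the variables of `Pf`, and `i` the maximum (1-indexed) level of the literals of
`C`. If the abstraction `Pf_i.(φ ∧ C̄)` has an SLD-Q-resolution refutation, then
`Pf.φ` and `Pf.(φ ∧ C)` are logically equivalent. -/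
theorem statement_12 (Pf : QPrefix) (φ : CNF) (hQH : IsQHorn Pf φ)
    (C : Clause) (hHorn : IsHornClause C) (hvars : clauseVars C ⊆ prefixVars Pf)
    (i : ℕ)
    (hub : ∀ l ∈ C, ∀ j, hasLevel Pf l.1 j → j + 1 ≤ i)
    (hmax : ∃ l ∈ C, hasLevel Pf l.1 (i - 1))
    (href : ∃ L : List Clause,
      IsSLDQRefutation (abstraction Pf i) (φ ∪ negUnits C) L) :
    LogEquiv Pf φ (insert C φ) := by
  intro σ
  refine ⟨fun ⟨hσ, hφ⟩ => ⟨hσ, fun a ha => ?_⟩, fun ⟨hσ, hφ⟩ =>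
    ⟨hσ, fun a ha D hD => hφ a ha D (Finset.mem_insert_of_mem hD)⟩⟩
  intro D hD
  rcases Finset.mem_insert.1 hD with rfl | hD
  swap
  · exact hφ a ha D hD
  by_contra hC
  obtain ⟨L, hL⟩ := href
  refine hL.false_of_cnfSat hQH.1.1 hσ ha fun b hb hba E hE => ?_
  rcases Finset.mem_union.1 hE with hE | hE
  · exact hφ b hb E hE
  · obtain ⟨l, hl, rfl⟩ := Finset.mem_image.1 hE
    obtain ⟨j, hj⟩ := mem_prefixVars_iff_hasLevel.1 (hvars (Finset.mem_image_of_mem _ hl))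
    have hbl : b l.1 = a l.1 :=
      hba _ (mem_varsUpTo.2 ⟨j, by have := hub l hl j hj; omega, hj⟩)
    have hal : a l.1 ≠ l.2 := fun h => hC ⟨l, hl, h⟩
    refine ⟨negLit l, Finset.mem_singleton_self _, ?_⟩
    rw [litSat, negLit, hbl]
    exact Bool.eq_not.2 hal

end QHornProlog
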